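/- Let p > 3 be prime. The number of regular subgroups G of Hol(M₁) with G isomorphic to M₁ and |Θ(G)| = p² equals (p⁴ − p³ − 2p² + 2p + 1)p, and the number of regular subgroups G of Hol(M₁) with G elementary abelian of order p³ and |Θ(G)| = p² equals (p² − 2)p². -/

import Mathlib

/-! ## The Heisenberg group of order `p³` -/

@[ext]
structure Heisenberg (p : ℕ) where
  x : ZMod p
  y : ZMod p
  z : ZMod p

namespace Heisenberg

variable {p : ℕ}

instance : Mul (Heisenberg p) :=
  ⟨fun g h => ⟨g.x + h.x, g.y + h.y, g.z + h.z + h.x * g.y⟩⟩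

instance : One (Heisenberg p) := ⟨⟨0, 0, 0⟩⟩

instance : Inv (Heisenberg p) := ⟨fun g => ⟨-g.x, -g.y, -g.z + g.x * g.y⟩⟩

@[simp] theorem mul_x (g h : Heisenberg p) : (g * h).x = g.x + h.x := rfl
@[simp] theorem mul_y (g h : Heisenberg p) : (g * h).y = g.y + h.y := rfl
@[simp] theorem mul_z (g h : Heisenberg p) : (g * h).z = g.z + h.z + h.x * g.y := rfl
@[simp] theorem one_x : (1 : Heisenberg p).x = 0 := rfl
@[simp] theorem one_y : (1 : Heisenberg p).y = 0 := rfl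
@[simp] theorem one_z : (1 : Heisenberg p).z = 0 := rfl
@[simp] theorem inv_x (g : Heisenberg p) : (g⁻¹).x = -g.x := rfl
@[simp] theorem inv_y (g : Heisenberg p) : (g⁻¹).y = -g.y := rfl
@[simp] theorem inv_z (g : Heisenberg p) : (g⁻¹).z = -g.z + g.x * g.y := rfl

instance : Group (Heisenberg p) where
  mul_assoc a b c := by ext <;> simp <;> ring
  one_mul a := by ext <;> simp
  mul_one a := by ext <;> simp
  inv_mul_cancel a := by ext <;> simp <;> ring

/-- The generator `ρ` (a generator of the centre). -/
def ρ : Heisenberg p := ⟨0, 0, 1⟩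

/-- The generator `σ`. -/
def σ : Heisenberg p := ⟨1, 0, 0⟩

/-- The generator `τ`. -/
def τ : Heisenberg p := ⟨0, 1, 0⟩

/-- The automorphism `α₁` determined by `σ ↦ ρσ`, `τ ↦ τ` (and `ρ ↦ ρ`). -/
def α₁ : MulAut (Heisenberg p) where
  toFun g := ⟨g.x, g.y, g.z + g.x⟩
  invFun g := ⟨g.x, g.y, g.z - g.x⟩
  left_inv g := by ext <;> simp
  right_inv g := by ext <;> simp
  map_mul' g h := by ext <;> simp <;> ring

/-- The automorphism `α₃` determined by `σ ↦ σ`, `τ ↦ ρτ` (and `ρ ↦ ρ`). -/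
def α₃ : MulAut (Heisenberg p) where
  toFun g := ⟨g.x, g.y, g.z + g.y⟩
  invFun g := ⟨g.x, g.y, g.z - g.y⟩
  left_inv g := by ext <;> simp
  right_inv g := by ext <;> simp
  map_mul' g h := by ext <;> simp <;> ring

/-- The automorphism `α₂` determined by `σ ↦ στ`, `τ ↦ τ` (and `ρ ↦ ρ`), for `p` an odd
prime. -/
def α₂ (p : ℕ) [Fact p.Prime] (hp : p ≠ 2) : MulAut (Heisenberg p) where
  toFun g := ⟨g.x, g.x + g.y, g.z + g.x * (g.x - 1) / 2⟩
  invFun g := ⟨g.x, g.y - g.x, g.z - g.x * (g.x - 1) / 2⟩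
  left_inv g := by ext <;> simp <;> ring
  right_inv g := by ext <;> simp <;> ring
  map_mul' g h := by
    have h2 : (2 : ZMod p) ≠ 0 := by
      intro h
      have h' : ((2 : ℕ) : ZMod p) = 0 := by exact_mod_cast h
      rw [CharP.cast_eq_zero_iff (ZMod p) p 2] at h'
      have h1 := Nat.le_of_dvd (by norm_num) h'
      have h2 := (Fact.out : p.Prime).two_le
      omega
    ext <;> simp
    · ring
    · field_simp
      ring

end Heisenberg

open Heisenberg

/-! ## The holomorph of `M₁` inside the permutation group -/

/-- The left regular representation `M₁ → Perm M₁`. -/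
def leftMulHom (p : ℕ) : Heisenberg p →* Equiv.Perm (Heisenberg p) :=
  MulAction.toPermHom (Heisenberg p) (Heisenberg p)

/-- The holomorph of `M₁`, realized as the subgroup of `Perm M₁` generated by left
translations and automorphisms of `M₁`. -/
def Hol (p : ℕ) : Subgroup (Equiv.Perm (Heisenberg p)) :=
  (leftMulHom p).range ⊔
    (MulAut.toPerm (Heisenberg p)).range

/-- A subgroup of `Perm X` is regular if it acts freely and transitively on `X`. -/
def IsRegularSub {X : Type*} (H : Subgroup (Equiv.Perm X)) : Prop :=
  ∀ x y : X, ∃! g : Equiv.Perm X, g ∈ H ∧ g x = y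

/-- The canonical projection `Θ : Hol(M₁) → Aut(M₁)` (with kernel the left translations),
written as a function on permutations: it sends `π` to `m ↦ (π 1)⁻¹ * π m`; on elements of the
holomorph, this is exactly the automorphism component. -/
def theta (p : ℕ) (π : Equiv.Perm (Heisenberg p)) : Equiv.Perm (Heisenberg p) :=
  (Equiv.mulLeft (π 1))⁻¹ * π

/-- The cardinality of the image `Θ(G)` of a subgroup `G` of the holomorph under the canonical
projection `Θ`. -/
noncomputable def thetaCard (p : ℕ) (G : Subgroup (Equiv.Perm (Heisenberg p))) : ℕ :=
  Nat.card (theta p '' (G : Set (Equiv.Perm (Heisenberg p))))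

/-- The conjugation action of `Aut(M₁)` (viewed inside `Perm M₁`) on subgroups of `Perm M₁`. -/
def autConj (p : ℕ) (α : MulAut (Heisenberg p)) (G : Subgroup (Equiv.Perm (Heisenberg p))) :
    Subgroup (Equiv.Perm (Heisenberg p)) :=
  Subgroup.map (MulAut.conj (MulAut.toPerm (Heisenberg p) α)).toMonoidHom G


/-- `G` is a regular subgroup of `Hol(M₁)` isomorphic to `M₁` whose image under the canonical
projection `Θ : Hol(M₁) → Aut(M₁)` has cardinality `r`. -/
def condM1 (p r : ℕ) (G : Subgroup (Equiv.Perm (Heisenberg p))) : Prop :=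
  G ≤ Hol p ∧ IsRegularSub G ∧ thetaCard p G = r ∧ Nonempty (G ≃* Heisenberg p)

/-- `G` is a regular subgroup of `Hol(M₁)`, elementary abelian of order `p³`, whose image under
the canonical projection `Θ : Hol(M₁) → Aut(M₁)` has cardinality `r`. -/
def condEA (p r : ℕ) (G : Subgroup (Equiv.Perm (Heisenberg p))) : Prop :=
  G ≤ Hol p ∧ IsRegularSub G ∧ thetaCard p G = r ∧
    Nonempty (G ≃* Multiplicative (ZMod p × ZMod p × ZMod p))


section GammaFunctions

variable {H : Type*} [Group H]

/-- A gamma function on a group `H`: a map `γ : H → Aut H` such that the permutations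
`h ↦ g * γ g h` form a (regular) subgroup of the holomorph. -/
def IsGamma (γ : H → MulAut H) : Prop :=
  ∀ g h, γ (g * γ g h) = γ g * γ h

/-- The permutation `h ↦ g * γ g h`. -/
def gammaPerm (γ : H → MulAut H) (g : H) : Equiv.Perm H :=
  Equiv.mulLeft g * MulAut.toPerm H (γ g)

theorem toPerm_apply (α : MulAut H) (x : H) : MulAut.toPerm H α x = α x := rfl

@[simp] theorem gammaPerm_apply (γ : H → MulAut H) (g h : H) :
    gammaPerm γ g h = g * γ g h := rfl

namespace IsGamma

variable {γ : H → MulAut H}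

theorem map_one (hγ : IsGamma γ) : γ 1 = 1 := by
  have h := hγ 1 1
  rw [_root_.map_one, mul_one] at h
  exact left_eq_mul.mp h

theorem gammaPerm_mul (hγ : IsGamma γ) (g h : H) :
    gammaPerm γ g * gammaPerm γ h = gammaPerm γ (g * γ g h) := by
  ext k
  simp [hγ g h, mul_assoc]

theorem gammaPerm_one (hγ : IsGamma γ) : gammaPerm γ 1 = 1 := by
  ext k
  simp [hγ.map_one]

theorem apply_inv (hγ : IsGamma γ) (g : H) : γ ((γ g)⁻¹ g⁻¹) = (γ g)⁻¹ := by
  have h := hγ g ((γ g)⁻¹ g⁻¹)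
  rw [MulAut.apply_inv_self, mul_inv_cancel, hγ.map_one] at h
  exact eq_inv_of_mul_eq_one_right h.symm

/-- The regular subgroup of permutations attached to a gamma function. -/
def subgroup (hγ : IsGamma γ) : Subgroup (Equiv.Perm H) where
  carrier := Set.range (gammaPerm γ)
  mul_mem' := by
    rintro _ _ ⟨g, rfl⟩ ⟨h, rfl⟩
    exact ⟨_, (hγ.gammaPerm_mul g h).symm⟩
  one_mem' := ⟨1, hγ.gammaPerm_one⟩
  inv_mem' := by
    rintro _ ⟨g, rfl⟩
    refine ⟨(γ g)⁻¹ g⁻¹, ?_⟩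
    rw [eq_inv_iff_mul_eq_one]
    refine mul_eq_one_iff_eq_inv.mpr (eq_inv_of_mul_eq_one_right ?_)
    rw [hγ.gammaPerm_mul, MulAut.apply_inv_self, mul_inv_cancel, hγ.gammaPerm_one]

theorem isRegularSub (hγ : IsGamma γ) : IsRegularSub hγ.subgroup := by
  have key : ∀ x y : H, ∃ π ∈ hγ.subgroup, π x = y := by
    intro x y
    refine ⟨gammaPerm γ y * (gammaPerm γ x)⁻¹,
      mul_mem ⟨y, rfl⟩ (inv_mem ⟨x, rfl⟩), ?_⟩
    have hx : gammaPerm γ x 1 = x := by simp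
    rw [Equiv.Perm.mul_apply, Equiv.Perm.inv_eq_iff_eq.mpr hx.symm]
    simp
  intro x y
  obtain ⟨π, hπ, hxy⟩ := key x y
  refine ⟨π, ⟨hπ, hxy⟩, ?_⟩
  rintro π' ⟨hπ', hxy'⟩
  obtain ⟨ν, ⟨g, rfl⟩, hg⟩ := key 1 x
  have e1 : gammaPerm γ g 1 = g := by simp
  obtain ⟨a, ha⟩ := mul_mem hπ (show gammaPerm γ g ∈ hγ.subgroup from ⟨g, rfl⟩)
  obtain ⟨b, hb⟩ := mul_mem hπ' (show gammaPerm γ g ∈ hγ.subgroup from ⟨g, rfl⟩)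
  have ha1 : a = y := by
    have := congrArg (fun f : Equiv.Perm H => f 1) ha
    simpa [← hxy, ← hg] using this
  have hb1 : b = y := by
    have := congrArg (fun f : Equiv.Perm H => f 1) hb
    simpa [← hxy', ← hg] using this
  rw [hb1, ← ha1, ha] at hb
  exact (mul_right_cancel hb).symm

theorem subgroup_injective {γ' : H → MulAut H} (hγ : IsGamma γ) (hγ' : IsGamma γ')
    (h : hγ.subgroup = hγ'.subgroup) : γ = γ' := by
  funext g
  have hg : gammaPerm γ g ∈ hγ'.subgroup := h ▸ ⟨g, rfl⟩
  obtain ⟨k, hk⟩ := hg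
  have hkg : k = g := by
    have := congrArg (fun f : Equiv.Perm H => f 1) hk
    simpa using this
  subst hkg
  ext x
  have := congrArg (fun f : Equiv.Perm H => f x) hk
  simpa using this.symm

theorem nonempty_mulEquiv (hγ : IsGamma γ) {K : Type*} [Group K] (e : H ≃ K)
    (he : ∀ g h, e (g * γ g h) = e g * e h) : Nonempty (hγ.subgroup ≃* K) := by
  let f : hγ.subgroup →* K :=
    MonoidHom.mk' (fun π => e (π.1 1)) (by
      rintro ⟨_, g, rfl⟩ ⟨_, h, rfl⟩
      simp [he])
  refine ⟨MulEquiv.ofBijective f ⟨?_, ?_⟩⟩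
  · rintro ⟨_, g, rfl⟩ ⟨_, h, rfl⟩ hgh
    have : g = h := by simpa [f] using hgh
    subst this
    rfl
  · intro k
    exact ⟨⟨gammaPerm γ (e.symm k), _, rfl⟩, by simp [f]⟩

/-- The image of a gamma function, as a subgroup of `Aut H`. -/
def image (hγ : IsGamma γ) : Subgroup (MulAut H) where
  carrier := Set.range γ
  mul_mem' := by
    rintro _ _ ⟨g, rfl⟩ ⟨h, rfl⟩
    exact ⟨_, hγ g h⟩
  one_mem' := ⟨1, hγ.map_one⟩
  inv_mem' := by
    rintro _ ⟨g, rfl⟩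
    exact ⟨_, hγ.apply_inv g⟩

end IsGamma

/-- The conjugate of a gamma function by an automorphism. -/
def conjGamma (θ : MulAut H) (γ : H → MulAut H) (g : H) : MulAut H :=
  θ * γ (θ⁻¹ g) * θ⁻¹

theorem IsGamma.conj {γ : H → MulAut H} (hγ : IsGamma γ) (θ : MulAut H) :
    IsGamma (conjGamma θ γ) := by
  intro g h
  have := hγ (θ⁻¹ g) (θ⁻¹ h)
  simp only [conjGamma, MulAut.mul_apply, map_mul, MulAut.inv_apply_self]
  rw [this]
  group

theorem conjGamma_inv_conjGamma (θ : MulAut H) (γ : H → MulAut H) :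
    conjGamma θ (conjGamma θ⁻¹ γ) = γ := by
  funext g
  simp only [conjGamma, inv_inv, MulAut.apply_inv_self]
  group

theorem card_range_conjGamma (θ : MulAut H) (γ : H → MulAut H) :
    Nat.card (Set.range (conjGamma θ γ)) = Nat.card (Set.range γ) := by
  have : Set.range (conjGamma θ γ) = MulAut.conj θ '' Set.range γ := by
    rw [← Set.range_comp, ← (θ⁻¹ : MulAut H).surjective.range_comp (MulAut.conj θ ∘ γ)]
    rfl
  rw [this, Nat.card_image_of_injective (MulAut.conj θ).injective]

end GammaFunctions

section Holomorph

variable {p : ℕ}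

theorem mem_Hol_iff {π : Equiv.Perm (Heisenberg p)} :
    π ∈ Hol p ↔ ∃ (g : Heisenberg p) (α : MulAut (Heisenberg p)),
      π = Equiv.mulLeft g * MulAut.toPerm (Heisenberg p) α := by
  constructor
  · intro h
    let K : Subgroup (Equiv.Perm (Heisenberg p)) :=
      { carrier := {π | ∃ (g : Heisenberg p) (α : MulAut (Heisenberg p)),
          π = Equiv.mulLeft g * MulAut.toPerm (Heisenberg p) α}
        mul_mem' := by
          rintro _ _ ⟨g, α, rfl⟩ ⟨h, β, rfl⟩
          refine ⟨g * α h, α * β, ?_⟩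
          ext1 k
          simp [mul_assoc, toPerm_apply]
        one_mem' := ⟨1, 1, by ext1 k; simp⟩
        inv_mem' := by
          rintro _ ⟨g, α, rfl⟩
          refine ⟨α⁻¹ g⁻¹, α⁻¹, ?_⟩
          rw [inv_eq_iff_mul_eq_one]
          ext1 k
          change g * α (α⁻¹ g⁻¹ * α⁻¹ k) = k
          rw [map_mul, MulAut.apply_inv_self, MulAut.apply_inv_self, mul_inv_cancel_left] }
    have hK : Hol p ≤ K := by
      refine sup_le ?_ ?_
      · rintro _ ⟨g, rfl⟩
        exact ⟨g, 1, by ext1 k; simp [leftMulHom]⟩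
      · rintro _ ⟨α, rfl⟩
        exact ⟨1, α, by ext1 k; simp⟩
    exact hK h
  · rintro ⟨g, α, rfl⟩
    refine mul_mem (Subgroup.mem_sup_left ⟨g, ?_⟩) (Subgroup.mem_sup_right ⟨α, rfl⟩)
    ext1 k
    simp [leftMulHom]

theorem IsGamma.subgroup_le_Hol {γ : Heisenberg p → MulAut (Heisenberg p)} (hγ : IsGamma γ) :
    hγ.subgroup ≤ Hol p := by
  rintro _ ⟨g, rfl⟩
  exact mem_Hol_iff.mpr ⟨g, γ g, rfl⟩

theorem IsGamma.thetaCard_subgroup {γ : Heisenberg p → MulAut (Heisenberg p)}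
    (hγ : IsGamma γ) : thetaCard p hγ.subgroup = Nat.card (Set.range γ) := by
  have hinj : Function.Injective (MulAut.toPerm (Heisenberg p)) := by
    intro f g h
    ext1 x
    exact congrArg (fun e : Equiv.Perm (Heisenberg p) => e x) h
  rw [thetaCard, ← Nat.card_image_of_injective hinj]
  congr 2
  rw [← Set.range_comp]
  change theta p '' Set.range (gammaPerm γ) = _
  rw [← Set.range_comp]
  congr 1
  funext g
  ext1 x
  simp [theta, Equiv.Perm.mul_apply, Equiv.mulLeft, toPerm_apply]

theorem exists_isGamma_of_isRegularSub {G : Subgroup (Equiv.Perm (Heisenberg p))}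
    (hG : G ≤ Hol p) (hreg : IsRegularSub G) :
    ∃ (γ : Heisenberg p → MulAut (Heisenberg p)) (hγ : IsGamma γ), hγ.subgroup = G := by
  have h1 : ∀ g : Heisenberg p, ∃ α : MulAut (Heisenberg p),
      Equiv.mulLeft g * MulAut.toPerm (Heisenberg p) α ∈ G := by
    intro g
    obtain ⟨π, ⟨hπ, hπ1⟩, -⟩ := hreg 1 g
    obtain ⟨g', α, rfl⟩ := mem_Hol_iff.mp (hG hπ)
    have : g' = g := by simpa [toPerm_apply] using hπ1
    subst this
    exact ⟨α, hπ⟩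
  choose γ hγG using h1
  have hG1 : ∀ g, gammaPerm γ g ∈ G := hγG
  have huniq : ∀ π ∈ G, π = gammaPerm γ (π 1) := fun π hπ =>
    (hreg 1 (π 1)).unique ⟨hπ, rfl⟩ ⟨hG1 _, by simp⟩
  have hγ : IsGamma γ := by
    intro g h
    have e := huniq _ (mul_mem (hG1 g) (hG1 h))
    ext1 k
    have := congrArg (fun e : Equiv.Perm (Heisenberg p) => e k) e
    simpa [mul_assoc] using this.symm
  refine ⟨γ, hγ, ?_⟩
  ext π
  constructor
  · rintro ⟨g, rfl⟩
    exact hG1 g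
  · intro hπ
    exact ⟨π 1, (huniq π hπ).symm⟩

end Holomorph

section ZModFacts

variable {p : ℕ}

theorem ZMod.eq_mul_of_additive {f : ZMod p → ZMod p} (hf : ∀ x y, f (x + y) = f x + f y)
    (x : ZMod p) : f x = f 1 * x := by
  have := ((AddMonoidHom.mk' f hf).toZModLinearMap p).map_smul x 1
  simpa [mul_comm] using this

variable [Fact p.Prime]

theorem ZMod.two_ne_zero_of_three_lt (h3 : 3 < p) : (2 : ZMod p) ≠ 0 := by
  intro h
  have h' : ((2 : ℕ) : ZMod p) = 0 := by exact_mod_cast h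
  rw [CharP.cast_eq_zero_iff (ZMod p) p 2] at h'
  have := Nat.le_of_dvd (by norm_num) h'
  omega

theorem ZMod.three_ne_zero_of_three_lt (h3 : 3 < p) : (3 : ZMod p) ≠ 0 := by
  intro h
  have h' : ((3 : ℕ) : ZMod p) = 0 := by exact_mod_cast h
  rw [CharP.cast_eq_zero_iff (ZMod p) p 3] at h'
  have := Nat.le_of_dvd (by norm_num) h'
  omega

end ZModFacts

namespace Heisenberg

variable {p : ℕ}

theorem mk_mul_mk (a b c a' b' c' : ZMod p) :
    (⟨a, b, c⟩ * ⟨a', b', c'⟩ : Heisenberg p) = ⟨a + a', b + b', c + c' + a' * b⟩ := rfl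

theorem one_def : (1 : Heisenberg p) = ⟨0, 0, 0⟩ := rfl

/-- The underlying set of the Heisenberg group. -/
def equivProd (p : ℕ) : Heisenberg p ≃ ZMod p × ZMod p × ZMod p where
  toFun g := (g.x, g.y, g.z)
  invFun v := ⟨v.1, v.2.1, v.2.2⟩

theorem eq_mul (g : Heisenberg p) :
    g = (⟨g.x, 0, 0⟩ : Heisenberg p) * ⟨0, g.y, 0⟩ * ⟨0, 0, g.z⟩ := by
  ext <;> simp

theorem ρ_eq : (ρ : Heisenberg p) = τ * σ * (σ * τ)⁻¹ := by
  ext <;> simp [ρ, σ, τ]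

theorem map_eq_of_hom {f : Heisenberg p → ZMod p} (hf : ∀ g h, f (g * h) = f g + f h)
    (g : Heisenberg p) : f g = f σ * g.x + f τ * g.y := by
  have hx : ∀ x, f ⟨x, 0, 0⟩ = f σ * x :=
    ZMod.eq_mul_of_additive (f := fun x => f ⟨x, 0, 0⟩) fun x y => by simp [← hf, mk_mul_mk]
  have hy : ∀ x, f ⟨0, x, 0⟩ = f τ * x :=
    ZMod.eq_mul_of_additive (f := fun x => f ⟨0, x, 0⟩) fun x y => by simp [← hf, mk_mul_mk]
  have hz : ∀ x, f ⟨0, 0, x⟩ = f ρ * x :=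
    ZMod.eq_mul_of_additive (f := fun x => f ⟨0, 0, x⟩) fun x y => by simp [← hf, mk_mul_mk]
  have hρ : f ρ = 0 := by
    have e : (ρ : Heisenberg p) * (σ * τ) = τ * σ := by ext <;> simp [ρ, σ, τ]
    have := congrArg f e
    rw [hf, hf, hf] at this
    linear_combination this
  conv_lhs => rw [eq_mul g]
  rw [hf, hf, hx, hy, hz, hρ]
  ring

theorem map_x (f : MulAut (Heisenberg p)) (g : Heisenberg p) :
    (f g).x = (f σ).x * g.x + (f τ).x * g.y :=
  map_eq_of_hom (f := fun g => (f g).x) (fun g h => by simp) g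

theorem map_y (f : MulAut (Heisenberg p)) (g : Heisenberg p) :
    (f g).y = (f σ).y * g.x + (f τ).y * g.y :=
  map_eq_of_hom (f := fun g => (f g).y) (fun g h => by simp) g

/-- The determinant of the action of an automorphism on the quotient by the centre. -/
def autDet (f : MulAut (Heisenberg p)) : ZMod p :=
  (f σ).x * (f τ).y - (f τ).x * (f σ).y

theorem map_center (f : MulAut (Heisenberg p)) (z : ZMod p) :
    f ⟨0, 0, z⟩ = ⟨0, 0, autDet f * z⟩ := by
  have hρ : (f ρ).z = autDet f := by
    rw [ρ_eq]
    simp [autDet]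
    ring
  have hxy : ∀ z, (f ⟨0, 0, z⟩).x = 0 ∧ (f ⟨0, 0, z⟩).y = 0 := fun z =>
    ⟨by rw [map_x]; simp, by rw [map_y]; simp⟩
  have hz := ZMod.eq_mul_of_additive (f := fun z => (f ⟨0, 0, z⟩).z) (fun x y => by
    have : (⟨0, 0, x + y⟩ : Heisenberg p) = ⟨0, 0, x⟩ * ⟨0, 0, y⟩ := by simp [mk_mul_mk]
    simp [this, hxy]) z
  ext
  · exact (hxy z).1
  · exact (hxy z).2
  · rw [← hρ]
    exact hz

theorem σ_pow (n : ℕ) : (σ : Heisenberg p) ^ n = ⟨n, 0, 0⟩ := by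
  induction n with
  | zero => simp [one_def]
  | succ n ih => rw [pow_succ, ih, σ, mk_mul_mk]; simp

theorem τ_pow (n : ℕ) : (τ : Heisenberg p) ^ n = ⟨0, n, 0⟩ := by
  induction n with
  | zero => simp [one_def]
  | succ n ih => rw [pow_succ, ih, τ, mk_mul_mk]; simp

theorem ρ_pow (n : ℕ) : (ρ : Heisenberg p) ^ n = ⟨0, 0, n⟩ := by
  induction n with
  | zero => simp [one_def]
  | succ n ih => rw [pow_succ, ih, ρ, mk_mul_mk]; simp

variable [Fact p.Prime]

instance : Finite (Heisenberg p) := Finite.of_equiv _ (equivProd p).symm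

theorem card_eq : Nat.card (Heisenberg p) = p ^ 3 := by
  rw [Nat.card_congr (equivProd p)]
  simp
  ring

theorem mulAut_ext {f f' : MulAut (Heisenberg p)} (hσ : f σ = f' σ) (hτ : f τ = f' τ) :
    f = f' := by
  have hρ : f ρ = f' ρ := by simp [ρ_eq, hσ, hτ]
  have e : ∀ g : Heisenberg p, g = σ ^ g.x.val * τ ^ g.y.val * ρ ^ g.z.val := fun g => by
    simp [σ_pow, τ_pow, ρ_pow, ← eq_mul]
  ext1 g
  rw [e g]
  simp [hσ, hτ, hρ]

theorem autDet_mul (f f' : MulAut (Heisenberg p)) :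
    autDet (f * f') = autDet f * autDet f' := by
  simp only [autDet, MulAut.mul_apply]
  rw [map_x f (f' σ), map_x f (f' τ), map_y f (f' σ), map_y f (f' τ)]
  ring

theorem autDet_pow (f : MulAut (Heisenberg p)) (n : ℕ) : autDet (f ^ n) = autDet f ^ n := by
  induction n with
  | zero => simp [autDet, σ, τ]
  | succ n ih => rw [pow_succ, autDet_mul, ih, pow_succ]

theorem autDet_eq_one_of_pow {f : MulAut (Heisenberg p)} {n : ℕ} (hf : f ^ p ^ n = 1) :
    autDet f = 1 := by
  have h := autDet_pow f (p ^ n)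
  rw [hf, ZMod.pow_card_pow] at h
  rw [← h]
  simp [autDet, σ, τ]

/-- A `p`-subgroup of `Aut(M₁)` fixes a nonzero vector of the quotient of `M₁` by its centre. -/
theorem exists_fixed_vector {R : Subgroup (MulAut (Heisenberg p))} (hR : IsPGroup p R) :
    ∃ q r : ZMod p, (q ≠ 0 ∨ r ≠ 0) ∧
      ∀ f ∈ R, (f ⟨q, r, 0⟩).x = q ∧ (f ⟨q, r, 0⟩).y = r := by
  let _ : MulAction R (ZMod p × ZMod p) :=
    { smul := fun f v => ((f.1 ⟨v.1, v.2, 0⟩).x, (f.1 ⟨v.1, v.2, 0⟩).y)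
      one_smul := fun v => rfl
      mul_smul := fun f f' v => by
        change ((f.1 (f'.1 ⟨v.1, v.2, 0⟩)).x, (f.1 (f'.1 ⟨v.1, v.2, 0⟩)).y) =
          ((f.1 ⟨(f'.1 ⟨v.1, v.2, 0⟩).x, (f'.1 ⟨v.1, v.2, 0⟩).y, 0⟩).x,
            (f.1 ⟨(f'.1 ⟨v.1, v.2, 0⟩).x, (f'.1 ⟨v.1, v.2, 0⟩).y, 0⟩).y)
        rw [map_x f.1, map_y f.1, map_x f.1 ⟨_, _, 0⟩, map_y f.1 ⟨_, _, 0⟩] }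
  have hsmul : ∀ (f : R) (v : ZMod p × ZMod p),
    f • v = ((f.1 ⟨v.1, v.2, 0⟩).x, (f.1 ⟨v.1, v.2, 0⟩).y) := fun _ _ => rfl
  have h0 : ((0, 0) : ZMod p × ZMod p) ∈ MulAction.fixedPoints R (ZMod p × ZMod p) := by
    intro f
    rw [hsmul, map_center]
  obtain ⟨⟨q, r⟩, hb, hne⟩ := hR.exists_fixed_point_of_prime_dvd_card_of_fixed_point
    (ZMod p × ZMod p) (by simp) h0
  refine ⟨q, r, ?_, fun f hf => ?_⟩
  · by_contra! h
    exact hne (by rw [h.1, h.2])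
  · have := hb ⟨f, hf⟩
    rw [hsmul] at this
    simpa using this

/-- The subgroups of index `p` in the Heisenberg group. -/
theorem exists_linear_form {T : Subgroup (Heisenberg p)} (hT : Nat.card T = p ^ 2) :
    ∃ r s : ZMod p, (r ≠ 0 ∨ s ≠ 0) ∧ ∀ g, g ∈ T ↔ r * g.x + s * g.y = 0 := by
  have hp : p.Prime := Fact.out
  have hidx : T.index = p := by
    have h := T.card_mul_index
    rw [hT, card_eq, pow_succ p 2] at h
    exact Nat.eq_of_mul_eq_mul_left (by have := hp.pos; positivity) h
  have hN : T.Normal := by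
    refine Subgroup.normal_of_index_eq_minFac_card ?_
    rw [hidx, card_eq, Nat.Prime.pow_minFac hp (by norm_num)]
  have hcard : Nat.card (Heisenberg p ⧸ T) = p := hidx
  have hcyc : IsCyclic (Heisenberg p ⧸ T) := isCyclic_of_prime_card hcard
  let e := (zmodCyclicMulEquiv hcyc).symm
  rw [hcard] at e
  let f : Heisenberg p → ZMod p := fun g => (e (g : Heisenberg p ⧸ T)).toAdd
  have hf : ∀ g h, f (g * h) = f g + f h := fun g h => by simp [f]
  have hmem : ∀ g, g ∈ T ↔ f σ * g.x + f τ * g.y = 0 := fun g => by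
    rw [← map_eq_of_hom hf, ← QuotientGroup.eq_one_iff]
    simp [f]
  refine ⟨f σ, f τ, ?_, hmem⟩
  by_contra! h
  have hT' : T = ⊤ := by
    rw [Subgroup.eq_top_iff']
    intro g
    rw [hmem, h.1, h.2]
    ring
  rw [hT', Subgroup.index_top] at hidx
  exact hp.one_lt.ne hidx

/-- The map underlying the unipotent automorphism with parameter `t`. -/
def unipFun (t g : Heisenberg p) : Heisenberg p :=
  ⟨g.x, g.y + t.x * g.x, g.z + t.z * g.x + t.y * g.y + t.x * (g.x ^ 2 / 2)⟩

theorem unipFun_unipFun (t t' g : Heisenberg p) :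
    unipFun t (unipFun t' g) = unipFun (t * t') g := by
  ext <;> simp [unipFun] <;> ring

theorem unipFun_one (g : Heisenberg p) : unipFun 1 g = g := by
  ext <;> simp [unipFun]

theorem unipFun_mul (h3 : 3 < p) (t g h : Heisenberg p) :
    unipFun t (g * h) = unipFun t g * unipFun t h := by
  have h2 := ZMod.two_ne_zero_of_three_lt h3
  ext
  · simp [unipFun]
  · simp [unipFun]
    ring
  · simp [unipFun]
    field_simp
    ring

/-- The automorphisms of the Heisenberg group acting trivially on the centre and fixing `τ`
modulo the centre. -/
def unip (h3 : 3 < p) : Heisenberg p →* MulAut (Heisenberg p) where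
  toFun t :=
    { toFun := unipFun t
      invFun := unipFun t⁻¹
      left_inv := fun g => by rw [unipFun_unipFun, inv_mul_cancel, unipFun_one]
      right_inv := fun g => by rw [unipFun_unipFun, mul_inv_cancel, unipFun_one]
      map_mul' := unipFun_mul h3 t }
  map_one' := MulEquiv.ext unipFun_one
  map_mul' t t' := MulEquiv.ext fun g => (unipFun_unipFun t t' g).symm

theorem unip_apply (h3 : 3 < p) (t g : Heisenberg p) : unip h3 t g =
    ⟨g.x, g.y + t.x * g.x, g.z + t.z * g.x + t.y * g.y + t.x * (g.x ^ 2 / 2)⟩ := rfl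

theorem unip_injective (h3 : 3 < p) : Function.Injective (unip h3) := by
  intro t t' h
  have hσ := congrArg (fun f : MulAut (Heisenberg p) => f σ) h
  have hτ := congrArg (fun f : MulAut (Heisenberg p) => f τ) h
  simp only [unip_apply, σ, τ, Heisenberg.mk.injEq] at hσ hτ
  have hx : t.x = t'.x := by linear_combination hσ.2.1
  ext
  · exact hx
  · linear_combination hτ.2.2
  · linear_combination hσ.2.2 - hx * (1 / 2)

theorem exists_unip_eq (h3 : 3 < p) {f : MulAut (Heisenberg p)} (hdet : autDet f = 1)
    (hx : (f τ).x = 0) (hy : (f τ).y = 1) : ∃ t, unip h3 t = f := by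
  rw [autDet, hx, hy] at hdet
  refine ⟨⟨(f σ).y, (f τ).z, (f σ).z - (f σ).y / 2⟩, mulAut_ext ?_ ?_⟩
  · ext
    · simp only [unip_apply, σ] at hdet ⊢
      linear_combination - hdet
    · simp [unip_apply, σ]
    · simp [unip_apply, σ]
      ring
  · ext
    · rw [hx]
      rfl
    · rw [hy]
      simp [unip_apply, τ]
    · simp [unip_apply, τ]

/-- Representatives of automorphisms moving the line of `τ` to the lines of the quotient of `M₁`
by its centre: the line of `τ` itself for `none`, and the line of `σ τ^m` for `some m`. -/
def lineAut (h3 : 3 < p) : Option (ZMod p) → MulAut (Heisenberg p)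
  | none => 1
  | some m =>
    { toFun := fun g => ⟨g.y, -g.x + m * g.y, g.z - g.x * g.y + m * (g.y ^ 2 / 2)⟩
      invFun := fun g => ⟨m * g.x - g.y, g.x,
        g.z + (m * g.x - g.y) * g.x - m * (g.x ^ 2 / 2)⟩
      left_inv := fun g => by ext <;> simp <;> ring
      right_inv := fun g => by ext <;> simp <;> ring
      map_mul' := fun g h => by
        have h2 := ZMod.two_ne_zero_of_three_lt h3
        ext
        · simp
        · simp
          ring
        · simp
          field_simp
          ring }

theorem lineAut_none (h3 : 3 < p) : lineAut h3 (none : Option (ZMod p)) = 1 := rfl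

theorem lineAut_some (h3 : 3 < p) (m : ZMod p) (g : Heisenberg p) : lineAut h3 (some m) g =
    ⟨g.y, -g.x + m * g.y, g.z - g.x * g.y + m * (g.y ^ 2 / 2)⟩ := rfl

theorem lineAut_some_symm (h3 : 3 < p) (m : ZMod p) (g : Heisenberg p) :
    (lineAut h3 (some m)).symm g =
      ⟨m * g.x - g.y, g.x, g.z + (m * g.x - g.y) * g.x - m * (g.x ^ 2 / 2)⟩ := rfl

theorem autDet_conj (θ f : MulAut (Heisenberg p)) : autDet (θ * f * θ⁻¹) = autDet f := by
  have h : autDet θ * autDet θ⁻¹ = 1 := by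
    rw [← autDet_mul, mul_inv_cancel]
    simp [autDet, σ, τ]
  rw [autDet_mul, autDet_mul]
  linear_combination autDet f * h

theorem exists_lineAut {q r : ZMod p} (h3 : 3 < p) (hqr : q ≠ 0 ∨ r ≠ 0) :
    ∃ (L : Option (ZMod p)) (c : ZMod p), c ≠ 0 ∧
      (lineAut h3 L ⟨0, c, 0⟩).x = q ∧ (lineAut h3 L ⟨0, c, 0⟩).y = r := by
  by_cases hq : q = 0
  · exact ⟨none, r, by simpa [hq] using hqr, by simp [lineAut_none, hq], by simp [lineAut_none]⟩
  · refine ⟨some (r / q), q, hq, by simp [lineAut_some], ?_⟩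
    simp [lineAut_some]
    field_simp

/-- If the image of a gamma function is a `p`-group then, up to conjugation by one of the
automorphisms `lineAut`, the gamma function has unipotent values. -/
theorem exists_conjGamma_eq_unip (h3 : 3 < p) {γ : Heisenberg p → MulAut (Heisenberg p)}
    (hγ : IsGamma γ) {n : ℕ} (hcard : Nat.card (Set.range γ) = p ^ n) :
    ∃ (L : Option (ZMod p)) (t : Heisenberg p → Heisenberg p),
      conjGamma (lineAut h3 L)⁻¹ γ = fun g => unip h3 (t g) := by
  have hcard' : Nat.card hγ.image = p ^ n := hcard
  obtain ⟨q, r, hqr, hfix⟩ := exists_fixed_vector (IsPGroup.of_card hcard')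
  obtain ⟨L, c, hc, hq, hr⟩ := exists_lineAut h3 hqr
  have hdet : ∀ g, autDet (γ g) = 1 := by
    intro g
    refine autDet_eq_one_of_pow (n := n) ?_
    have : (⟨γ g, g, rfl⟩ : hγ.image) ^ p ^ n = 1 := by
      rw [← hcard']
      exact pow_card_eq_one'
    exact congrArg Subtype.val this
  have key : ∀ g, ∃ t, unip h3 t = conjGamma (lineAut h3 L)⁻¹ γ g := by
    intro g
    have hdet' : autDet (conjGamma (lineAut h3 L)⁻¹ γ g) = 1 := by
      rw [conjGamma, autDet_conj, hdet]
    set f := conjGamma (lineAut h3 L)⁻¹ γ g with hf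
    set θ := lineAut h3 L with hθ
    have hθf : θ * f = γ (θ g) * θ := by
      rw [hf, conjGamma, inv_inv]
      group
    have e1 : θ (f ⟨0, c, 0⟩) = γ (θ g) (θ ⟨0, c, 0⟩) :=
      congrArg (fun f : MulAut (Heisenberg p) => f ⟨0, c, 0⟩) hθf
    obtain ⟨hx, hy⟩ := hfix (γ (θ g)) ⟨_, rfl⟩
    have ex : (θ (f ⟨0, c, 0⟩)).x = (θ ⟨0, c, 0⟩).x := by
      rw [map_x] at hx
      rw [e1, map_x, hq, hr]
      exact hx
    have ey : (θ (f ⟨0, c, 0⟩)).y = (θ ⟨0, c, 0⟩).y := by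
      rw [map_y] at hy
      rw [e1, map_y, hq, hr]
      exact hy
    have e2 : θ⁻¹ (θ (f ⟨0, c, 0⟩)) = f ⟨0, c, 0⟩ := MulAut.inv_apply_self _ _ _
    have e3 : θ⁻¹ (θ ⟨0, c, 0⟩) = (⟨0, c, 0⟩ : Heisenberg p) := MulAut.inv_apply_self _ _ _
    have fx : (f ⟨0, c, 0⟩).x = 0 := by
      rw [← e2, map_x, ex, ey, ← map_x, e3]
    have fy : (f ⟨0, c, 0⟩).y = c := by
      rw [← e2, map_y, ex, ey, ← map_y, e3]
    rw [map_x] at fx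
    rw [map_y] at fy
    refine exists_unip_eq h3 hdet' ?_ ?_
    · exact (mul_eq_zero.mp (by simpa using fx)).resolve_right hc
    · exact mul_right_cancel₀ hc (by simpa using fy)
  choose t ht using key
  exact ⟨L, t, funext fun g => (ht g).symm⟩

/-- The identity satisfied by `t` when `unip ∘ t` is a gamma function. -/
theorem isGamma_unip_iff (h3 : 3 < p) {t : Heisenberg p → Heisenberg p} :
    IsGamma (fun g => unip h3 (t g)) ↔ ∀ g h, t (g * unip h3 (t g) h) = t g * t h := by
  refine forall₂_congr fun g h => ?_
  rw [← map_mul]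
  exact (unip_injective h3).eq_iff

theorem card_range_unip (h3 : 3 < p) (t : Heisenberg p → Heisenberg p) :
    Nat.card (Set.range fun g => unip h3 (t g)) = Nat.card (Set.range t) := by
  rw [Set.range_comp' (unip h3) t, Nat.card_image_of_injective (unip_injective h3)]

/-- If the image of `unip ∘ t` has order `p²`, it is the kernel of a linear form. -/
theorem exists_linear_form_range (h3 : 3 < p) {t : Heisenberg p → Heisenberg p}
    (ht : IsGamma fun g => unip h3 (t g)) (hcard : Nat.card (Set.range t) = p ^ 2) :
    ∃ r s : ZMod p, (r ≠ 0 ∨ s ≠ 0) ∧ ∀ k, (∃ g, t g = k) ↔ r * k.x + s * k.y = 0 := by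
  have hT : ((ht.image.comap (unip h3) : Subgroup _) : Set (Heisenberg p)) = Set.range t := by
    ext k
    exact exists_congr fun g => (unip_injective h3).eq_iff
  obtain ⟨r, s, hrs, h⟩ := exists_linear_form (T := ht.image.comap (unip h3))
    (by rw [← hcard, ← hT]; rfl)
  refine ⟨r, s, hrs, fun k => ?_⟩
  rw [← h k, ← SetLike.mem_coe, hT]
  rfl

/-- The parameters of the gamma functions whose image is the group of automorphisms acting
trivially modulo the centre. -/
def innerParam (b c a d : ZMod p) (g : Heisenberg p) : Heisenberg p :=
  ⟨0, c * g.x + d * g.y, a * g.x + b * g.y⟩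

/-- The parameters of the gamma functions whose image is a noncentral subgroup of order `p²` of
the group of unipotent automorphisms. -/
def outerParam (k l a b : ZMod p) (g : Heisenberg p) : Heisenberg p :=
  ⟨k * g.x, l * k * g.x, a * g.x + b * (g.y - k * (g.x ^ 2 / 2)) + l * k ^ 2 * (g.x ^ 2 / 2)⟩

theorem isGamma_innerParam (h3 : 3 < p) (b c a d : ZMod p) :
    IsGamma fun g => unip h3 (innerParam b c a d g) := by
  rw [isGamma_unip_iff]
  intro g h
  ext <;> simp [innerParam, unip_apply] <;> ring

theorem isGamma_outerParam (h3 : 3 < p) (k l a b : ZMod p) :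
    IsGamma fun g => unip h3 (outerParam k l a b g) := by
  have h2 := ZMod.two_ne_zero_of_three_lt h3
  rw [isGamma_unip_iff]
  intro g h
  ext
  · simp [outerParam, unip_apply]
    ring
  · simp [outerParam, unip_apply]
    ring
  · simp [outerParam, unip_apply]
    field_simp
    ring

theorem card_range_of_forall_mem {t : Heisenberg p → Heisenberg p}
    {f : ZMod p × ZMod p → Heisenberg p} (hf : Function.Injective f)
    (h1 : ∀ g, ∃ v, f v = t g) (h2 : ∀ v, ∃ g, t g = f v) :
    Nat.card (Set.range t) = p ^ 2 := by
  have : Set.range t = Set.range f := by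
    ext k
    constructor
    · rintro ⟨g, rfl⟩
      exact h1 g
    · rintro ⟨v, rfl⟩
      exact h2 v
  rw [this, Nat.card_range_of_injective hf]
  simp
  ring

theorem card_range_innerParam {b c a d : ZMod p} (h : a * d - b * c ≠ 0) :
    Nat.card (Set.range (innerParam b c a d)) = p ^ 2 := by
  refine card_range_of_forall_mem (f := fun v => ⟨0, v.1, v.2⟩) ?_ ?_ ?_
  · rintro ⟨v, w⟩ ⟨v', w'⟩ h
    simpa using h
  · exact fun g => ⟨(_, _), rfl⟩
  · rintro ⟨v, w⟩
    refine ⟨⟨(d * w - b * v) / (a * d - b * c), (a * v - c * w) / (a * d - b * c), 0⟩, ?_⟩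
    ext
    · rfl
    · simp only [innerParam]
      rw [mul_div_assoc', mul_div_assoc', ← add_div, div_eq_iff h]
      ring
    · simp only [innerParam]
      rw [mul_div_assoc', mul_div_assoc', ← add_div, div_eq_iff h]
      ring

theorem card_range_outerParam {k l a b : ZMod p} (hb : b ≠ 0) (hk : k ≠ 0) :
    Nat.card (Set.range (outerParam k l a b)) = p ^ 2 := by
  refine card_range_of_forall_mem (f := fun v => ⟨v.1, l * v.1, v.2⟩) ?_ ?_ ?_
  · rintro ⟨v, w⟩ ⟨v', w'⟩ h
    simp only [Heisenberg.mk.injEq] at h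
    exact Prod.ext h.1 h.2.2
  · exact fun g => ⟨((outerParam k l a b g).x, (outerParam k l a b g).z), by
      simp [outerParam, mul_assoc]⟩
  · rintro ⟨v, w⟩
    refine ⟨⟨v / k, (w - a * (v / k) - l * k ^ 2 * ((v / k) ^ 2 / 2)) / b +
      k * ((v / k) ^ 2 / 2), 0⟩, ?_⟩
    ext
    · simp only [outerParam]
      field_simp
    · simp only [outerParam]
      field_simp
    · simp only [outerParam]
      rw [add_sub_cancel_right, mul_div_cancel₀ _ hb]
      ring

theorem exists_eq_innerParam (h3 : 3 < p) {t : Heisenberg p → Heisenberg p}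
    (ht : IsGamma fun g => unip h3 (t g)) (hr : ∀ k, (∃ g, t g = k) ↔ k.x = 0) :
    ∃ b c a d : ZMod p, a * d - b * c ≠ 0 ∧ t = innerParam b c a d := by
  rw [isGamma_unip_iff] at ht
  have hx : ∀ g, (t g).x = 0 := fun g => (hr _).mp ⟨g, rfl⟩
  have circ : ∀ g h : Heisenberg p, g * unip h3 (t g) h = ⟨g.x + h.x, g.y + h.y,
      g.z + (h.z + (t g).z * h.x + (t g).y * h.y) + h.x * g.y⟩ := fun g h => by
    ext <;> simp [unip_apply, hx]
  have key : ∀ f : Heisenberg p → ZMod p,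
      (∀ g h, f ⟨g.x + h.x, g.y + h.y,
        g.z + (h.z + (t g).z * h.x + (t g).y * h.y) + h.x * g.y⟩ = f g + f h) →
      (∀ x y z w, f ⟨x, y, z + w⟩ = f ⟨x, y, z⟩ + f ρ * w) ∧
        f ρ * (t ρ).z = 0 ∧ f ρ * (t ρ).y = 0 := by
    intro f hf
    have hz : ∀ z, f ⟨0, 0, z⟩ = f ρ * z :=
      ZMod.eq_mul_of_additive (f := fun z => f ⟨0, 0, z⟩) fun z w => by
        simpa using hf ⟨0, 0, z⟩ ⟨0, 0, w⟩
    have hs : ∀ x y z w, f ⟨x, y, z + w⟩ = f ⟨x, y, z⟩ + f ρ * w := fun x y z w => by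
      simpa [hz] using hf ⟨x, y, z⟩ ⟨0, 0, w⟩
    have h1 := hf ρ σ
    have h2 := hf ρ τ
    have e : (ρ : Heisenberg p) = ⟨0, 0, 1⟩ := rfl
    simp only [e, σ, τ] at h1 h2 hs ⊢
    simp at h1 h2
    have s1 := hs 1 0 0 (1 + (t ⟨0, 0, 1⟩).z)
    have s2 := hs 0 1 0 (1 + (t ⟨0, 0, 1⟩).y)
    rw [zero_add] at s1 s2
    refine ⟨hs, ?_, ?_⟩
    · linear_combination h1 - s1
    · linear_combination h2 - s2
  have hfz : ∀ g h, (t ⟨g.x + h.x, g.y + h.y,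
      g.z + (h.z + (t g).z * h.x + (t g).y * h.y) + h.x * g.y⟩).z = (t g).z + (t h).z :=
    fun g h => by rw [← circ, ht]; simp [hx]
  have hfy : ∀ g h, (t ⟨g.x + h.x, g.y + h.y,
      g.z + (h.z + (t g).z * h.x + (t g).y * h.y) + h.x * g.y⟩).y = (t g).y + (t h).y :=
    fun g h => by rw [← circ, ht]; simp
  obtain ⟨sz, z0, -⟩ := key (fun g => (t g).z) hfz
  obtain ⟨sy, -, y0⟩ := key (fun g => (t g).y) hfy
  have hz0 := mul_self_eq_zero.mp z0
  have hy0 := mul_self_eq_zero.mp y0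
  have lin : ∀ f : Heisenberg p → ZMod p,
      (∀ g h, f ⟨g.x + h.x, g.y + h.y,
        g.z + (h.z + (t g).z * h.x + (t g).y * h.y) + h.x * g.y⟩ = f g + f h) →
      (∀ x y z w, f ⟨x, y, z + w⟩ = f ⟨x, y, z⟩ + f ρ * w) → f ρ = 0 →
      ∀ g, f g = f σ * g.x + f τ * g.y := by
    intro f hf hs h0
    refine map_eq_of_hom fun g h => ?_
    have e : ∀ x y z, f ⟨x, y, z⟩ = f ⟨x, y, 0⟩ := fun x y z => by
      simpa [h0] using hs x y 0 z
    rw [← hf, e]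
    exact (e _ _ _).symm
  have lz := lin (fun g => (t g).z) hfz sz hz0
  have ly := lin (fun g => (t g).y) hfy sy hy0
  refine ⟨(t τ).z, (t σ).y, (t σ).z, (t τ).y, ?_, ?_⟩
  · intro hdet
    obtain ⟨g, hg⟩ := (hr ⟨0, 1, 0⟩).mpr rfl
    obtain ⟨h, hh⟩ := (hr ⟨0, 0, 1⟩).mpr rfl
    have g1 := ly g
    have g2 := lz g
    have k1 := ly h
    have k2 := lz h
    rw [hg] at g1 g2
    rw [hh] at k1 k2
    simp only at g1 g2 k1 k2
    have : (1 : ZMod p) = 0 := by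
      linear_combination (g.y * h.x - g.x * h.y) * hdet + g1 * ((t σ).z * h.x + (t τ).z * h.y)
        + k2 - g2 * ((t σ).y * h.x + (t τ).y * h.y)
    exact one_ne_zero this
  · funext g
    ext
    · exact hx g
    · exact ly g
    · exact lz g

theorem center_eq_zero_of_isGamma_unip (h3 : 3 < p) {c a : Heisenberg p → ZMod p} {l : ZMod p}
    (hc : ∀ g h : Heisenberg p, c ⟨g.x + h.x, g.y + h.y + c g * h.x,
      g.z + (h.z + a g * h.x + l * c g * h.y + c g * (h.x ^ 2 / 2)) + h.x * g.y⟩ = c g + c h)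
    (ha : ∀ g h : Heisenberg p, a ⟨g.x + h.x, g.y + h.y + c g * h.x,
      g.z + (h.z + a g * h.x + l * c g * h.y + c g * (h.x ^ 2 / 2)) + h.x * g.y⟩ =
        a g + a h + l * c g * c h) :
    c ρ = 0 := by
  have h2 := ZMod.two_ne_zero_of_three_lt h3
  have hz : ∀ z, c ⟨0, 0, z⟩ = c ρ * z :=
    ZMod.eq_mul_of_additive (f := fun z => c ⟨0, 0, z⟩) fun z w => by
      simpa using hc ⟨0, 0, z⟩ ⟨0, 0, w⟩
  have hs : ∀ x y z w, c ⟨x, y, z + w⟩ = c ⟨x, y, z⟩ + c ρ * w := fun x y z w => by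
    simpa [hz] using hc ⟨x, y, z⟩ ⟨0, 0, w⟩
  by_contra h0
  have hl : l = 0 := by
    have h1 := hc ρ τ
    have s1 := hs 0 1 0 (1 + l * c ρ)
    simp only [ρ, τ, zero_add, mul_zero, mul_one, add_zero, zero_pow two_ne_zero, zero_div]
      at h1
    simp only [ρ, zero_add] at s1
    rw [s1] at h1
    have : l * (c ρ * c ρ) = 0 := by
      simp only [ρ]
      linear_combination h1
    simpa [h0] using this
  have key : ∀ f : Heisenberg p → ZMod p,
      (∀ g h, f ⟨g.x + h.x, g.y + h.y + c g * h.x,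
        g.z + (h.z + a g * h.x + c g * (h.x ^ 2 / 2)) + h.x * g.y⟩ = f g + f h) →
      ∀ n : Heisenberg p, n.x = 0 →
        f τ * c n + f ρ * (a n + n.y + c n / 2) = 0 := by
    rintro f hf ⟨x, y, z⟩ (rfl : x = 0)
    have hz : ∀ z, f ⟨0, 0, z⟩ = f ρ * z :=
      ZMod.eq_mul_of_additive (f := fun z => f ⟨0, 0, z⟩) fun z w => by
        simpa using hf ⟨0, 0, z⟩ ⟨0, 0, w⟩
    have hy : ∀ y, f ⟨0, y, 0⟩ = f τ * y :=
      ZMod.eq_mul_of_additive (f := fun y => f ⟨0, y, 0⟩) fun y w => by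
        simpa using hf ⟨0, y, 0⟩ ⟨0, w, 0⟩
    have hN : ∀ y z, f ⟨0, y, z⟩ = f τ * y + f ρ * z := fun y z => by
      simpa [hz, hy] using hf ⟨0, y, 0⟩ ⟨0, 0, z⟩
    have hσ : ∀ y z, f ⟨1, y, z⟩ = f σ + (f τ * y + f ρ * z) := fun y z => by
      simpa [hN, σ] using hf σ ⟨0, y, z⟩
    have e := hf ⟨0, y, z⟩ σ
    have ex : (σ : Heisenberg p).x = 1 := rfl
    have ey : (σ : Heisenberg p).y = 0 := rfl
    have ez : (σ : Heisenberg p).z = 0 := rfl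
    simp only [ex, ey, ez, zero_add, hσ, hN] at e
    linear_combination e
  have hcl := key c (fun g h => by simpa [hl] using hc g h)
  have hal := key a (fun g h => by simpa [hl] using ha g h)
  have E1 := hcl ρ rfl
  have E2 := hcl τ rfl
  have E3 := hal ρ rfl
  simp only [ρ, τ] at E1 E2 E3 h0
  set c0 := c ⟨0, 0, 1⟩
  set c1 := c ⟨0, 1, 0⟩
  set a0 := a ⟨0, 0, 1⟩
  set a1 := a ⟨0, 1, 0⟩
  have F1 : c1 + a0 + c0 / 2 = 0 := by
    have : c0 * (c1 + a0 + c0 / 2) = 0 := by linear_combination E1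
    exact (mul_eq_zero.mp this).resolve_left h0
  apply h0
  linear_combination E2 - E3 + a0 * F1 - c1 * F1

theorem exists_eq_outerParam (h3 : 3 < p) {t : Heisenberg p → Heisenberg p} {l : ZMod p}
    (ht : IsGamma fun g => unip h3 (t g)) (hr : ∀ k, (∃ g, t g = k) ↔ k.y = l * k.x) :
    ∃ k l a b : ZMod p, (b ≠ 0 ∧ k ≠ 0) ∧ t = outerParam k l a b := by
  have h2 := ZMod.two_ne_zero_of_three_lt h3
  rw [isGamma_unip_iff] at ht
  have hb : ∀ g, (t g).y = l * (t g).x := fun g => (hr _).mp ⟨g, rfl⟩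
  have circ : ∀ g h : Heisenberg p, g * unip h3 (t g) h =
      ⟨g.x + h.x, g.y + h.y + (t g).x * h.x, g.z + (h.z + (t g).z * h.x + l * (t g).x * h.y +
        (t g).x * (h.x ^ 2 / 2)) + h.x * g.y⟩ := fun g h => by
    ext <;> simp [unip_apply, hb, add_assoc]
  obtain ⟨c, hcdef⟩ : ∃ c : Heisenberg p → ZMod p, ∀ g, (t g).x = c g := ⟨_, fun _ => rfl⟩
  obtain ⟨a, hadef⟩ : ∃ a : Heisenberg p → ZMod p, ∀ g, (t g).z = a g := ⟨_, fun _ => rfl⟩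
  have hc : ∀ g h : Heisenberg p, c ⟨g.x + h.x, g.y + h.y + c g * h.x,
      g.z + (h.z + a g * h.x + l * c g * h.y + c g * (h.x ^ 2 / 2)) + h.x * g.y⟩ =
        c g + c h := fun g h => by
    simp only [← hcdef, ← hadef]
    rw [← circ, ht]
    simp
  have ha : ∀ g h : Heisenberg p, a ⟨g.x + h.x, g.y + h.y + c g * h.x,
      g.z + (h.z + a g * h.x + l * c g * h.y + c g * (h.x ^ 2 / 2)) + h.x * g.y⟩ =
        a g + a h + l * c g * c h := fun g h => by
    simp only [← hcdef, ← hadef]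
    rw [← circ, ht]
    simp [hb]
    ring
  have hc0 := center_eq_zero_of_isGamma_unip h3 hc ha
  have hcz : ∀ x y z, c ⟨x, y, z⟩ = c ⟨x, y, 0⟩ := by
    have hz : ∀ z, c ⟨0, 0, z⟩ = 0 := fun z => by
      rw [ZMod.eq_mul_of_additive (f := fun z => c ⟨0, 0, z⟩) (fun z w => by
        simpa using hc ⟨0, 0, z⟩ ⟨0, 0, w⟩) z]
      change c ρ * z = 0
      rw [hc0, zero_mul]
    exact fun x y z => by simpa [hz] using hc ⟨x, y, 0⟩ ⟨0, 0, z⟩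
  have hcy : ∀ y, c ⟨0, y, 0⟩ = c τ * y :=
    ZMod.eq_mul_of_additive (f := fun y => c ⟨0, y, 0⟩) fun y w => by
      have := hc ⟨0, y, 0⟩ ⟨0, w, 0⟩
      rw [hcz] at this
      simpa using this
  have hc1 : c τ = 0 := by
    have e1 := hc τ σ
    have e2 := hc σ ⟨0, 1 + c τ, 0⟩
    rw [hcz] at e1 e2
    rw [hcy] at e2
    simp [σ, τ] at e1 e2
    have : c τ * c τ = 0 := by
      simp only [τ]
      linear_combination e1 - e2
    exact mul_self_eq_zero.mp this
  have hcx : ∀ x y z, c ⟨x, y, z⟩ = c ⟨x, 0, 0⟩ := fun x y z => by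
    have := hc ⟨x, 0, 0⟩ ⟨0, y, 0⟩
    rw [hcz, hcy, hc1] at this
    rw [hcz]
    simpa using this
  have hck : ∀ g, c g = c σ * g.x := fun g => by
    have := map_eq_of_hom (f := c) (fun g h => by
      rw [← hc, hcx]
      exact (hcx _ _ _).symm) g
    rw [this, hc1]
    ring
  set k := c σ with hk
  have haz : ∀ z, a ⟨0, 0, z⟩ = a ρ * z :=
    ZMod.eq_mul_of_additive (f := fun z => a ⟨0, 0, z⟩) fun z w => by
      simpa [hck] using ha ⟨0, 0, z⟩ ⟨0, 0, w⟩
  have has : ∀ x y z w, a ⟨x, y, z + w⟩ = a ⟨x, y, z⟩ + a ρ * w := fun x y z w => by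
    simpa [hck, haz] using ha ⟨x, y, z⟩ ⟨0, 0, w⟩
  have ha0 : a ρ = 0 := by
    have e1 := ha ρ σ
    have e2 := has 1 0 0 (1 + a ρ)
    simp [hck, σ, ρ] at e1 e2
    have : a ρ * a ρ = 0 := by
      simp only [ρ]
      linear_combination e1 - e2
    exact mul_self_eq_zero.mp this
  have ha' : ∀ x y z, a ⟨x, y, z⟩ = a ⟨x, y, 0⟩ := fun x y z => by
    simpa [ha0] using has x y 0 z
  obtain ⟨A, B, hAB⟩ : ∃ A B, ∀ g : Heisenberg p,
      a ⟨g.x, g.y + k * (g.x ^ 2 / 2), 0⟩ - l * k ^ 2 * (g.x ^ 2 / 2) = A * g.x + B * g.y :=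
    ⟨_, _, map_eq_of_hom (f := fun g : Heisenberg p =>
      a ⟨g.x, g.y + k * (g.x ^ 2 / 2), 0⟩ - l * k ^ 2 * (g.x ^ 2 / 2)) fun g h => by
        have e := ha ⟨g.x, g.y + k * (g.x ^ 2 / 2), 0⟩ ⟨h.x, h.y + k * (h.x ^ 2 / 2), 0⟩
        rw [ha'] at e
        simp only [hck] at e
        have ey : g.y + h.y + k * ((g.x + h.x) ^ 2 / 2) =
            g.y + k * (g.x ^ 2 / 2) + (h.y + k * (h.x ^ 2 / 2)) + k * g.x * h.x := by
          field_simp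
          ring
        simp only [mul_x, mul_y, ey, e]
        field_simp
        ring⟩
  have hak : ∀ g, a g = A * g.x + B * (g.y - k * (g.x ^ 2 / 2)) + l * k ^ 2 * (g.x ^ 2 / 2) := by
    rintro ⟨x, y, z⟩
    have := hAB ⟨x, y - k * (x ^ 2 / 2), 0⟩
    simp only [sub_add_cancel] at this
    rw [ha']
    linear_combination this
  refine ⟨k, l, A, B, ⟨?_, ?_⟩, ?_⟩
  · rintro rfl
    obtain ⟨g, hg⟩ := (hr ⟨1, l, 0⟩).mpr (by simp)
    obtain ⟨h, hh⟩ := (hr ⟨0, 0, 1⟩).mpr (by simp)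
    have g1 := hck g
    have k1 := hck h
    have k2 := hak h
    rw [← hcdef, hg] at g1
    rw [← hcdef, hh] at k1
    rw [← hadef, hh] at k2
    simp only at g1 k1 k2
    have hk0 : k ≠ 0 := by
      rintro h0
      rw [h0, zero_mul] at g1
      exact one_ne_zero g1
    have hx : h.x = 0 := (mul_eq_zero.mp k1.symm).resolve_left hk0
    rw [hx] at k2
    simp at k2
  · intro h0
    obtain ⟨g, hg⟩ := (hr ⟨1, l, 0⟩).mpr (by simp)
    have g1 := hck g
    rw [← hcdef, hg, h0, zero_mul] at g1
    exact one_ne_zero g1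
  · funext g
    ext
    · exact (hcdef g).trans (hck g)
    · rw [hb, hcdef, hck, outerParam, mul_assoc]
    · exact (hadef g).trans (hak g)

end Heisenberg

namespace Heisenberg

variable {p : ℕ}

/-- In suitable coordinates, the group law `g * γ g h` attached to the gamma function `γ` is
that of a Heisenberg group with commutator pairing scaled by `δ`. -/
def HasNormalForm (γ : Heisenberg p → MulAut (Heisenberg p)) (δ : ZMod p) : Prop :=
  ∃ e : Heisenberg p ≃ Heisenberg p, ∀ g h, e (g * γ g h) =
    ⟨(e g).x + (e h).x, (e g).y + (e h).y, (e g).z + (e h).z + δ * ((e h).x * (e g).y)⟩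

theorem HasNormalForm.conj {γ : Heisenberg p → MulAut (Heisenberg p)} {δ : ZMod p}
    (h : HasNormalForm γ δ) (θ : MulAut (Heisenberg p)) : HasNormalForm (conjGamma θ γ) δ := by
  obtain ⟨e, he⟩ := h
  refine ⟨(θ⁻¹ : MulAut (Heisenberg p)).toEquiv.trans e, fun g h => ?_⟩
  have := he (θ⁻¹ g) (θ⁻¹ h)
  simpa [conjGamma] using this

variable [Fact p.Prime]

theorem HasNormalForm.nonempty_mulEquiv_heisenberg {γ : Heisenberg p → MulAut (Heisenberg p)}
    {δ : ZMod p} (h : HasNormalForm γ δ) (hγ : IsGamma γ) (hδ : δ ≠ 0) :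
    Nonempty (hγ.subgroup ≃* Heisenberg p) := by
  obtain ⟨e, he⟩ := h
  let s : Heisenberg p ≃ Heisenberg p :=
    { toFun := fun g => ⟨g.x, g.y, g.z / δ⟩
      invFun := fun g => ⟨g.x, g.y, g.z * δ⟩
      left_inv := fun g => by ext <;> simp [hδ]
      right_inv := fun g => by ext <;> simp [hδ] }
  refine hγ.nonempty_mulEquiv (e.trans s) fun g h => ?_
  simp only [Equiv.trans_apply, he]
  ext
  · simp [s]
  · simp [s]
  · simp [s]
    field_simp

theorem HasNormalForm.nonempty_mulEquiv_multiplicative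
    {γ : Heisenberg p → MulAut (Heisenberg p)} (h : HasNormalForm γ 0) (hγ : IsGamma γ) :
    Nonempty (hγ.subgroup ≃* Multiplicative (ZMod p × ZMod p × ZMod p)) := by
  obtain ⟨e, he⟩ := h
  let s : Heisenberg p ≃ Multiplicative (ZMod p × ZMod p × ZMod p) :=
    { toFun := fun g => Multiplicative.ofAdd (g.x, g.y, g.z)
      invFun := fun v => ⟨v.toAdd.1, v.toAdd.2.1, v.toAdd.2.2⟩
      left_inv := fun g => rfl
      right_inv := fun v => rfl }
  refine hγ.nonempty_mulEquiv (e.trans s) fun g h => ?_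
  simp only [Equiv.trans_apply, he]
  rw [zero_mul, add_zero]
  rfl

theorem not_nonempty_mulEquiv_of_comm {K : Type*} [CommGroup K] :
    ¬ Nonempty (Heisenberg p ≃* K) := by
  rintro ⟨e⟩
  have h : (τ * σ : Heisenberg p) = σ * τ := e.injective (by rw [map_mul, map_mul, mul_comm])
  simpa [τ, σ] using congrArg Heisenberg.z h

theorem hasNormalForm_innerParam (h3 : 3 < p) (b c a d : ZMod p) :
    HasNormalForm (fun g => unip h3 (innerParam b c a d g)) (b + 1 - c) := by
  have h2 := ZMod.two_ne_zero_of_three_lt h3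
  refine ⟨⟨fun g => ⟨g.x, g.y, g.z - (a * g.x ^ 2 / 2 + d * g.y ^ 2 / 2 + c * g.x * g.y)⟩,
    fun g => ⟨g.x, g.y, g.z + (a * g.x ^ 2 / 2 + d * g.y ^ 2 / 2 + c * g.x * g.y)⟩,
    fun g => by simp, fun g => by simp⟩, fun g h => ?_⟩
  ext
  · simp [unip_apply]
  · simp [unip_apply, innerParam]
  · simp [unip_apply, innerParam]
    field_simp
    ring

theorem hasNormalForm_outerParam (h3 : 3 < p) (k l a b : ZMod p) :
    HasNormalForm (fun g => unip h3 (outerParam k l a b g)) (b + 1 - l * k) := by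
  have h2 := ZMod.two_ne_zero_of_three_lt h3
  have h3' := ZMod.three_ne_zero_of_three_lt h3
  refine ⟨⟨fun g => ⟨g.x, g.y - k * (g.x ^ 2 / 2), g.z - (a * g.x ^ 2 / 2 +
      (l * k ^ 2 + k) * g.x ^ 3 / (2 * 3) + l * k * g.x * (g.y - k * (g.x ^ 2 / 2)))⟩,
    fun g => ⟨g.x, g.y + k * (g.x ^ 2 / 2), g.z + (a * g.x ^ 2 / 2 +
      (l * k ^ 2 + k) * g.x ^ 3 / (2 * 3) + l * k * g.x * g.y)⟩,
    fun g => by simp, fun g => by simp⟩, fun g h => ?_⟩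
  ext
  · simp [unip_apply]
  · simp [unip_apply, outerParam]
    field_simp
    ring
  · simp [unip_apply, outerParam]
    field_simp
    ring

end Heisenberg

namespace Heisenberg

variable {p : ℕ}

/-- The parameters of the gamma functions with image of order `p ^ 2`. -/
abbrev Param (p : ℕ) : Type :=
  (ZMod p × ZMod p × ZMod p × ZMod p) ⊕
    (Option (ZMod p) × ZMod p × ZMod p × ZMod p × ZMod p)

/-- The parameters whose gamma function has image of order exactly `p ^ 2`. -/
def Param.Valid : Param p → Prop
  | .inl (b, c, a, d) => a * d - b * c ≠ 0
  | .inr (_, k, _, _, b) => b ≠ 0 ∧ k ≠ 0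

/-- The scaling factor of the commutator pairing of the regular subgroup with given parameters. -/
def Param.delta : Param p → ZMod p
  | .inl (b, c, _, _) => b + 1 - c
  | .inr (_, k, l, _, b) => b + 1 - l * k

variable [Fact p.Prime]

/-- The gamma function with given parameters. -/
def Param.gamma (h3 : 3 < p) : Param p → Heisenberg p → MulAut (Heisenberg p)
  | .inl (b, c, a, d) => fun g => unip h3 (innerParam b c a d g)
  | .inr (L, k, l, a, b) =>
    conjGamma (lineAut h3 L) fun g => unip h3 (outerParam k l a b g)

theorem Param.isGamma_gamma (h3 : 3 < p) : ∀ q : Param p, IsGamma (q.gamma h3)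
  | .inl (b, c, a, d) => isGamma_innerParam h3 b c a d
  | .inr (L, k, l, a, b) => (isGamma_outerParam h3 k l a b).conj (lineAut h3 L)

theorem Param.hasNormalForm_gamma (h3 : 3 < p) : ∀ q : Param p,
    HasNormalForm (q.gamma h3) q.delta
  | .inl (b, c, a, d) => hasNormalForm_innerParam h3 b c a d
  | .inr (L, k, l, a, b) => (hasNormalForm_outerParam h3 k l a b).conj (lineAut h3 L)

theorem Param.card_range_gamma (h3 : 3 < p) {q : Param p} (hq : q.Valid) :
    Nat.card (Set.range (q.gamma h3)) = p ^ 2 := by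
  rcases q with ⟨b, c, a, d⟩ | ⟨L, k, l, a, b⟩
  · rw [gamma, card_range_unip, card_range_innerParam hq]
  · rw [gamma, card_range_conjGamma, card_range_unip, card_range_outerParam hq.1 hq.2]

theorem innerParam_injective {b c a d b' c' a' d' : ZMod p}
    (h : innerParam b c a d = innerParam b' c' a' d') : b = b' ∧ c = c' ∧ a = a' ∧ d = d' := by
  have hσ := congrFun h σ
  have hτ := congrFun h τ
  simp [innerParam, σ, τ] at hσ hτ
  tauto

theorem outerParam_injective {k l a b k' l' a' b' : ZMod p} (hk : k ≠ 0)
    (h : outerParam k l a b = outerParam k' l' a' b') :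
    k = k' ∧ l = l' ∧ a = a' ∧ b = b' := by
  have hσ := congrFun h σ
  have hτ := congrFun h τ
  simp [outerParam, σ, τ] at hσ hτ
  obtain ⟨rfl, hl, ha⟩ := hσ
  obtain rfl := mul_right_cancel₀ hk hl
  subst hτ
  exact ⟨rfl, rfl, add_right_cancel (add_right_cancel ha), rfl⟩

theorem conjGamma_injective {H : Type*} [Group H] (θ : MulAut H) :
    Function.Injective (conjGamma θ) := fun γ γ' h => by
  have := congrArg (conjGamma θ⁻¹) h
  rw [← conjGamma_inv_conjGamma θ⁻¹ γ, ← conjGamma_inv_conjGamma θ⁻¹ γ', inv_inv, h]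

theorem unip_comp_injective (h3 : 3 < p) {t t' : Heisenberg p → Heisenberg p}
    (h : (fun g => unip h3 (t g)) = fun g => unip h3 (t' g)) : t = t' :=
  funext fun g => unip_injective h3 (congrFun h g)

theorem Param.gamma_injOn (h3 : 3 < p) :
    Set.InjOn (Param.gamma h3) {q : Param p | q.Valid} := by
  have inl_ne : ∀ (b c a d k l a' b' : ZMod p) L, k ≠ 0 →
      Param.gamma h3 (.inl (b, c, a, d)) ≠ Param.gamma h3 (.inr (L, k, l, a', b')) := by
    intro b c a d k l a' b' L hk h
    cases L with
    | none =>
      have := congrArg Heisenberg.y (DFunLike.congr_fun (congrFun h σ) σ)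
      simp [gamma, conjGamma, lineAut_none, unip_apply, innerParam, outerParam, σ] at this
      exact hk this.symm
    | some m =>
      have := congrArg Heisenberg.x (DFunLike.congr_fun (congrFun h τ) τ)
      simp [gamma, conjGamma, lineAut_some, lineAut_some_symm, unip_apply, innerParam,
        outerParam, τ] at this
      exact hk this.symm
  have none_ne : ∀ (k l a b k' l' a' b' m : ZMod p), k' ≠ 0 →
      Param.gamma h3 (.inr (none, k, l, a, b)) ≠
        Param.gamma h3 (.inr (some m, k', l', a', b')) := by
    intro k l a b k' l' a' b' m hk h
    have := congrArg Heisenberg.x (DFunLike.congr_fun (congrFun h τ) τ)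
    simp [gamma, conjGamma, lineAut_none, lineAut_some, lineAut_some_symm, unip_apply,
      outerParam, τ] at this
    exact hk this.symm
  rintro (⟨b, c, a, d⟩ | ⟨L, k, l, a, b⟩) hq (⟨b', c', a', d'⟩ | ⟨L', k', l', a', b'⟩) hq' h
  · obtain ⟨rfl, rfl, rfl, rfl⟩ := innerParam_injective (unip_comp_injective h3 h)
    rfl
  · exact (inl_ne _ _ _ _ _ _ _ _ _ hq'.2 h).elim
  · exact (inl_ne _ _ _ _ _ _ _ _ _ hq.2 h.symm).elim
  · have hL : L = L' := by
      rcases L with _ | m <;> rcases L' with _ | m'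
      · rfl
      · exact (none_ne _ _ _ _ _ _ _ _ _ hq'.2 h).elim
      · exact (none_ne _ _ _ _ _ _ _ _ _ hq.2 h.symm).elim
      · have e1 := congrArg Heisenberg.x (DFunLike.congr_fun (congrFun h τ) τ)
        have e2 := congrArg Heisenberg.y (DFunLike.congr_fun (congrFun h τ) τ)
        simp [gamma, conjGamma, lineAut_some, lineAut_some_symm, unip_apply,
          outerParam, τ] at e1 e2
        rw [e1] at e2
        have : (m - m') * k' = 0 := by linear_combination e2
        rw [sub_eq_zero.mp ((mul_eq_zero.mp this).resolve_right hq'.2)]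
    subst hL
    obtain ⟨rfl, rfl, rfl, rfl⟩ := outerParam_injective hq.2
      (unip_comp_injective h3 (conjGamma_injective _ h))
    rfl

theorem exists_gamma_inl_eq (h3 : 3 < p) {t : Heisenberg p → Heisenberg p}
    (ht : IsGamma fun g => unip h3 (t g)) (hcard : Nat.card (Set.range t) = p ^ 2)
    (hx : ∀ g, (t g).x = 0) :
    ∃ q : Param p, q.Valid ∧ q.gamma h3 = fun g => unip h3 (t g) := by
  obtain ⟨r, s, hrs, H⟩ := exists_linear_form_range h3 ht hcard
  obtain ⟨g, hg⟩ := (H ⟨s, -r, 0⟩).mpr (by ring)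
  have hs : s = 0 := by
    have := hx g
    rwa [hg] at this
  have hr : r ≠ 0 := by simpa [hs] using hrs
  obtain ⟨b, c, a, d, hdet, rfl⟩ := exists_eq_innerParam h3 ht fun k => by
    simp [H k, hs, hr]
  exact ⟨.inl (b, c, a, d), hdet, rfl⟩

theorem exists_unip_eq_lineAut_conj (h3 : 3 < p) (L : Option (ZMod p)) {t : Heisenberg p}
    (ht : t.x = 0) :
    ∃ t', t'.x = 0 ∧ unip h3 t' = lineAut h3 L * unip h3 t * (lineAut h3 L)⁻¹ := by
  cases L with
  | none => exact ⟨t, ht, by simp [lineAut_none]⟩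
  | some m =>
    obtain ⟨t', h'⟩ := exists_unip_eq h3
      (f := lineAut h3 (some m) * unip h3 t * (lineAut h3 (some m))⁻¹)
      (by rw [autDet_conj]; simp [autDet, unip_apply, σ, τ])
      (by simp [lineAut_some, lineAut_some_symm, unip_apply, ht, τ])
      (by simp [lineAut_some, lineAut_some_symm, unip_apply, ht, τ])
    refine ⟨t', ?_, h'⟩
    have := congrArg Heisenberg.y (DFunLike.congr_fun h' σ)
    simpa [lineAut_some, lineAut_some_symm, unip_apply, ht, σ] using this

theorem exists_gamma_eq (h3 : 3 < p) {γ : Heisenberg p → MulAut (Heisenberg p)}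
    (hγ : IsGamma γ) (hcard : Nat.card (Set.range γ) = p ^ 2) :
    ∃ q : Param p, q.Valid ∧ q.gamma h3 = γ := by
  obtain ⟨L, t, h⟩ := exists_conjGamma_eq_unip h3 hγ hcard
  have hγt : conjGamma (lineAut h3 L) (fun g => unip h3 (t g)) = γ := by
    rw [← h, conjGamma_inv_conjGamma]
  have ht : IsGamma fun g => unip h3 (t g) := h ▸ hγ.conj _
  have hc : Nat.card (Set.range t) = p ^ 2 := by
    rw [← card_range_unip h3, ← h, card_range_conjGamma, hcard]
  obtain ⟨r, s, hrs, H⟩ := exists_linear_form_range h3 ht hc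
  by_cases hs : s = 0
  · have hr : r ≠ 0 := by simpa [hs] using hrs
    have hx : ∀ g, (t g).x = 0 := fun g => by simpa [hs, hr] using (H _).mp ⟨g, rfl⟩
    choose t' hx' ht' using fun g =>
      exists_unip_eq_lineAut_conj h3 L (hx ((lineAut h3 L)⁻¹ g))
    have e : (fun g => unip h3 (t' g)) = γ := by
      rw [← hγt]
      exact funext ht'
    obtain ⟨q, hq, hqt⟩ := exists_gamma_inl_eq h3 (e ▸ hγ)
      (by rw [← card_range_unip h3, e, hcard]) hx'
    exact ⟨q, hq, hqt.trans e⟩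
  · obtain ⟨k, l, a, b, hkb, rfl⟩ := exists_eq_outerParam h3 (l := -r / s) ht fun k => by
      rw [H k, div_mul_eq_mul_div, eq_div_iff hs]
      constructor <;> intro h <;> linear_combination h
    exact ⟨.inr (L, k, l, a, b), hkb, hγt⟩

theorem card_condM1_eq (h3 : 3 < p) :
    Nat.card {G : Subgroup (Equiv.Perm (Heisenberg p)) // condM1 p (p ^ 2) G} =
      Nat.card {q : Param p // q.Valid ∧ q.delta ≠ 0} := by
  refine (Nat.card_eq_of_bijective
    (fun q => ⟨(q.1.isGamma_gamma h3).subgroup, IsGamma.subgroup_le_Hol _,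
      IsGamma.isRegularSub _, (IsGamma.thetaCard_subgroup _).trans
        (Param.card_range_gamma h3 q.2.1),
      (q.1.hasNormalForm_gamma h3).nonempty_mulEquiv_heisenberg _ q.2.2⟩) ⟨?_, ?_⟩).symm
  · rintro ⟨q, hq⟩ ⟨q', hq'⟩ h
    exact Subtype.ext (Param.gamma_injOn h3 hq.1 hq'.1
      (IsGamma.subgroup_injective
      (q.isGamma_gamma h3) (q'.isGamma_gamma h3) (congrArg Subtype.val h)))
  · rintro ⟨G, hG, hreg, hcard, e⟩
    obtain ⟨γ, hγ, rfl⟩ := exists_isGamma_of_isRegularSub hG hreg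
    rw [hγ.thetaCard_subgroup] at hcard
    obtain ⟨q, hq, rfl⟩ := exists_gamma_eq h3 hγ hcard
    refine ⟨⟨q, hq, fun hδ => ?_⟩, rfl⟩
    have hf := q.hasNormalForm_gamma h3
    rw [hδ] at hf
    obtain ⟨e⟩ := e
    obtain ⟨e'⟩ := hf.nonempty_mulEquiv_multiplicative hγ
    exact not_nonempty_mulEquiv_of_comm ⟨e.symm.trans e'⟩

theorem card_condEA_eq (h3 : 3 < p) :
    Nat.card {G : Subgroup (Equiv.Perm (Heisenberg p)) // condEA p (p ^ 2) G} =
      Nat.card {q : Param p // q.Valid ∧ q.delta = 0} := by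
  refine (Nat.card_eq_of_bijective
    (fun q => ⟨(q.1.isGamma_gamma h3).subgroup, IsGamma.subgroup_le_Hol _,
      IsGamma.isRegularSub _, (IsGamma.thetaCard_subgroup _).trans
        (Param.card_range_gamma h3 q.2.1),
      HasNormalForm.nonempty_mulEquiv_multiplicative
        (by simpa only [q.2.2] using q.1.hasNormalForm_gamma h3) _⟩) ⟨?_, ?_⟩).symm
  · rintro ⟨q, hq⟩ ⟨q', hq'⟩ h
    exact Subtype.ext (Param.gamma_injOn h3 hq.1 hq'.1
      (IsGamma.subgroup_injective
      (q.isGamma_gamma h3) (q'.isGamma_gamma h3) (congrArg Subtype.val h)))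
  · rintro ⟨G, hG, hreg, hcard, e⟩
    obtain ⟨γ, hγ, rfl⟩ := exists_isGamma_of_isRegularSub hG hreg
    rw [hγ.thetaCard_subgroup] at hcard
    obtain ⟨q, hq, rfl⟩ := exists_gamma_eq h3 hγ hcard
    refine ⟨⟨q, hq, by_contra fun hδ => ?_⟩, rfl⟩
    obtain ⟨e⟩ := e
    obtain ⟨e'⟩ := (q.hasNormalForm_gamma h3).nonempty_mulEquiv_heisenberg hγ hδ
    exact not_nonempty_mulEquiv_of_comm ⟨e'.symm.trans e⟩

theorem card_units_zmod : (Nat.card (ZMod p)ˣ : ℤ) = p - 1 := by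
  rw [Nat.card_eq_fintype_card, ZMod.card_units, Nat.cast_sub (Fact.out : p.Prime).one_le,
    Nat.cast_one]

theorem card_inl_valid :
    (Nat.card {v : ZMod p × ZMod p × ZMod p × ZMod p // Param.Valid (.inl v)} : ℤ) =
      (p ^ 2 - 1) * (p ^ 2 - p) := by
  have hp := (Fact.out : p.Prime).one_le
  have h : Nat.card {v : ZMod p × ZMod p × ZMod p × ZMod p // Param.Valid (.inl v)} =
      Nat.card (Matrix.GeneralLinearGroup (Fin 2) (ZMod p)) := by
    refine (Nat.card_eq_of_bijective
      (fun M : Matrix.GeneralLinearGroup (Fin 2) (ZMod p) =>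
        ⟨(M.1 0 1, M.1 1 0, M.1 0 0, M.1 1 1), by
          simpa [Param.Valid, Matrix.det_fin_two] using M.det.ne_zero⟩) ⟨?_, ?_⟩).symm
    · intro M N h
      simp only [Subtype.mk.injEq, Prod.mk.injEq] at h
      ext i j
      fin_cases i <;> fin_cases j <;> simp [h]
    · rintro ⟨⟨b, c, a, d⟩, h⟩
      exact ⟨Matrix.GeneralLinearGroup.mkOfDetNeZero !![a, b; c, d]
        (by rwa [Matrix.det_fin_two_of]), rfl⟩
  rw [h, Matrix.card_GL_field]
  simp only [Fin.prod_univ_two, Fintype.card_eq_nat_card, Nat.card_zmod]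
  rw [Nat.cast_mul, Nat.cast_sub (by simp [Nat.one_le_pow _ _ hp]),
    Nat.cast_sub (by simpa using Nat.pow_le_pow_right hp one_le_two)]
  simp

theorem card_inl_delta_eq_zero :
    (Nat.card {v : ZMod p × ZMod p × ZMod p × ZMod p //
      Param.Valid (.inl v) ∧ Param.delta (.inl v) = 0} : ℤ) = p ^ 3 - p ^ 2 - p := by
  have h : Nat.card {v : ZMod p × ZMod p × ZMod p × ZMod p //
      Param.Valid (.inl v) ∧ Param.delta (.inl v) = 0} =
      Nat.card ((ZMod p × (ZMod p)ˣ × (ZMod p)ˣ) ⊕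
        ({b : ZMod p // b * (b + 1) ≠ 0} × ZMod p)) := by
    refine (Nat.card_eq_of_bijective (Sum.elim
      (fun v : ZMod p × (ZMod p)ˣ × (ZMod p)ˣ =>
        ⟨(v.1, v.1 + 1, (v.2.2 + v.1 * (v.1 + 1)) / v.2.1, v.2.1),
          by simp [Param.Valid], by simp [Param.delta]⟩)
      fun v : {b : ZMod p // b * (b + 1) ≠ 0} × ZMod p => ⟨(v.1, v.1 + 1, v.2, 0), by
          simpa [Param.Valid] using v.1.2, by simp [Param.delta]⟩) ⟨?_, ?_⟩).symm
    · rintro (⟨b, d, u⟩ | ⟨b, a⟩) (⟨b', d', u'⟩ | ⟨b', a'⟩) h <;>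
        obtain ⟨hb, -, ha, hd⟩ : _ ∧ _ ∧ _ ∧ _ := by
          simpa only [Sum.elim_inl, Sum.elim_inr, Prod.mk.injEq] using congrArg Subtype.val h
      · obtain rfl := hb
        obtain rfl := Units.ext hd
        rw [div_left_inj' d.ne_zero, add_left_inj] at ha
        rw [Units.ext ha]
      · exact (d.ne_zero hd).elim
      · exact (d'.ne_zero hd.symm).elim
      · obtain rfl := Subtype.ext hb
        rw [show a = a' from ha]
    · rintro ⟨⟨b, c, a, d⟩, h, hδ⟩
      obtain rfl : b + 1 = c := sub_eq_zero.mp hδ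
      by_cases hd : d = 0
      · subst hd
        refine ⟨.inr (⟨b, ?_⟩, a), rfl⟩
        simpa [Param.Valid] using h
      · have hu : a * d - b * (b + 1) ≠ 0 := h
        refine ⟨.inl (b, Units.mk0 d hd, Units.mk0 _ hu), ?_⟩
        simp only [Sum.elim_inl, Subtype.mk.injEq, Units.val_mk0, sub_add_cancel]
        rw [mul_div_cancel_right₀ _ hd]
  have h2 : (Nat.card {b : ZMod p // b * (b + 1) ≠ 0} : ℤ) = p - 2 := by
    have e : {b : ZMod p | b * (b + 1) ≠ 0} = {0, -1}ᶜ := by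
      ext b
      simp [eq_neg_iff_add_eq_zero]
    have h01 : (0 : ZMod p) ≠ -1 := by simp
    have := Set.ncard_add_ncard_compl ({0, -1} : Set (ZMod p))
    rw [Set.ncard_pair h01, Nat.card_zmod, ← e, ← Nat.card_coe_set_eq] at this
    change (Nat.card ↥{b : ZMod p | b * (b + 1) ≠ 0} : ℤ) = p - 2
    omega
  rw [h]
  simp only [Nat.card_sum, Nat.card_prod, Nat.cast_add, Nat.cast_mul, card_units_zmod, h2,
    Nat.card_zmod]
  ring

theorem card_option_zmod : (Nat.card (Option (ZMod p)) : ℤ) = p + 1 := by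
  simp

theorem card_inr_valid :
    (Nat.card {v : Option (ZMod p) × ZMod p × ZMod p × ZMod p × ZMod p //
      Param.Valid (.inr v)} : ℤ) = (p + 1) * (p - 1) ^ 2 * p ^ 2 := by
  have h : Nat.card {v : Option (ZMod p) × ZMod p × ZMod p × ZMod p × ZMod p //
      Param.Valid (.inr v)} =
      Nat.card (Option (ZMod p) × (ZMod p)ˣ × ZMod p × ZMod p × (ZMod p)ˣ) := by
    refine (Nat.card_eq_of_bijective
      (fun v : Option (ZMod p) × (ZMod p)ˣ × ZMod p × ZMod p × (ZMod p)ˣ =>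
        ⟨(v.1, v.2.1, v.2.2.1, v.2.2.2.1, v.2.2.2.2), by simp [Param.Valid]⟩) ⟨?_, ?_⟩).symm
    · rintro ⟨L, k, l, a, b⟩ ⟨L', k', l', a', b'⟩ h
      simpa only [Prod.mk.injEq, Units.val_inj] using congrArg Subtype.val h
    · rintro ⟨⟨L, k, l, a, b⟩, hb, hk⟩
      exact ⟨(L, Units.mk0 k hk, l, a, Units.mk0 b hb), rfl⟩
  rw [h]
  simp only [Nat.card_prod, Nat.cast_mul, card_units_zmod, card_option_zmod, Nat.card_zmod]
  ring

theorem card_inr_delta_eq_zero :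
    (Nat.card {v : Option (ZMod p) × ZMod p × ZMod p × ZMod p × ZMod p //
      Param.Valid (.inr v) ∧ Param.delta (.inr v) = 0} : ℤ) = (p + 1) * (p - 1) ^ 2 * p := by
  have h : Nat.card {v : Option (ZMod p) × ZMod p × ZMod p × ZMod p × ZMod p //
      Param.Valid (.inr v) ∧ Param.delta (.inr v) = 0} =
      Nat.card (Option (ZMod p) × (ZMod p)ˣ × ZMod p × (ZMod p)ˣ) := by
    refine (Nat.card_eq_of_bijective
      (fun v : Option (ZMod p) × (ZMod p)ˣ × ZMod p × (ZMod p)ˣ =>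
        ⟨(v.1, v.2.1, (v.2.2.2 + 1) / v.2.1, v.2.2.1, v.2.2.2),
          by simp [Param.Valid], by simp [Param.delta]⟩) ⟨?_, ?_⟩).symm
    · rintro ⟨L, k, a, b⟩ ⟨L', k', a', b'⟩ h
      have := congrArg Subtype.val h
      simp only [Prod.mk.injEq, Units.val_inj] at this ⊢
      tauto
    · rintro ⟨⟨L, k, l, a, b⟩, ⟨hb, hk⟩, hδ⟩
      have hl : b + 1 = l * k := sub_eq_zero.mp hδ
      exact ⟨(L, Units.mk0 k hk, a, Units.mk0 b hb), by simp [hl, hk]⟩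
  rw [h]
  simp only [Nat.card_prod, Nat.cast_mul, card_units_zmod, card_option_zmod, Nat.card_zmod]
  ring

theorem Param.card_subtype (P : Param p → Prop) :
    Nat.card {q // P q} = Nat.card {v // P (.inl v)} + Nat.card {v // P (.inr v)} := by
  rw [Nat.card_congr Equiv.subtypeSum, Nat.card_sum]

theorem Param.card_delta_eq_zero :
    (Nat.card {q : Param p // q.Valid ∧ q.delta = 0} : ℤ) = (p ^ 2 - 2) * p ^ 2 := by
  rw [card_subtype, Nat.cast_add, card_inl_delta_eq_zero, card_inr_delta_eq_zero]
  ring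

theorem Param.card_delta_ne_zero :
    (Nat.card {q : Param p // q.Valid ∧ q.delta ≠ 0} : ℤ) =
      (p ^ 4 - p ^ 3 - 2 * p ^ 2 + 2 * p + 1) * p := by
  classical
  have h1 : (Nat.card {q : Param p // q.Valid} : ℤ) =
      (p ^ 2 - 1) * (p ^ 2 - p) + (p + 1) * (p - 1) ^ 2 * p ^ 2 := by
    rw [card_subtype, Nat.cast_add, card_inl_valid, card_inr_valid]
  have h2 : Nat.card {q : Param p // q.Valid ∧ q.delta = 0} +
      Nat.card {q : Param p // q.Valid ∧ q.delta ≠ 0} = Nat.card {q : Param p // q.Valid} := by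
    rw [← Nat.card_congr (Equiv.sumCompl fun q : {q : Param p // q.Valid} => q.1.delta = 0),
      Nat.card_sum]
    exact congrArg₂ _ (Nat.card_congr (Equiv.subtypeSubtypeEquivSubtypeInter _ _)).symm
      (Nat.card_congr (Equiv.subtypeSubtypeEquivSubtypeInter _
        (fun q : Param p => q.delta ≠ 0))).symm
  zify at h2
  linear_combination h2 + h1 - card_delta_eq_zero (p := p)

end Heisenberg

/-- There are `(p⁴ − p³ − 2p² + 2p + 1)p` regular subgroups of `Hol(M₁)`
isomorphic to `M₁` with `|Θ(G)| = p²`, and `(p² − 2)p²` elementary abelian ones. -/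
theorem count_regular_subgroups_theta_p_sq (p : ℕ) [Fact p.Prime] (h3 : 3 < p) :
    Nat.card {G : Subgroup (Equiv.Perm (Heisenberg p)) // condM1 p (p ^ 2) G} =
      (p ^ 4 - p ^ 3 - 2 * p ^ 2 + 2 * p + 1) * p ∧
    Nat.card {G : Subgroup (Equiv.Perm (Heisenberg p)) // condEA p (p ^ 2) G} =
      (p ^ 2 - 2) * p ^ 2 := by
  have h1 : 2 * p ^ 2 ≤ p ^ 4 - p ^ 3 := by
    refine Nat.le_sub_of_add_le ?_
    nlinarith [Nat.pow_le_pow_left h3 2, Nat.mul_le_mul_right (p ^ 2) (Nat.mul_le_mul_right p h3),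
      Nat.mul_le_mul_right (p ^ 2) h3]
  have h2 : p ^ 3 ≤ p ^ 4 := Nat.pow_le_pow_right (by omega) (by norm_num)
  have h3' : 2 ≤ p ^ 2 := by nlinarith
  rw [card_condM1_eq h3, card_condEA_eq h3]
  constructor
  · zify [h1, h2]
    exact Param.card_delta_ne_zero
  · zify [h3']
    exact Param.card_delta_eq_zero
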